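/- Let A = (a_{ij}) be an r×s matrix of nonnegative integers. Call A decomposable if there exist partitions {1,…,r} = I ⊔ I′ and {1,…,s} = J ⊔ J′ with I ∪ J and I′ ∪ J′ both nonempty, such that a_{ij} = 0 whenever (i ∈ I and j ∈ J′) or (i ∈ I′ and j ∈ J). Suppose A is not decomposable and there exist positive integers m₁,…,m_r and n₁,…,n_s with Σ_{j=1}^s a_{ij} n_j = 2m_i for all i and Σ_{i=1}^r a_{ij} m_i = 2n_j for all j. Then the symmetric real (r+s)×(r+s) matrix C, given in block form by C = [[2·Id_r, −A], [−Aᵗ, 2·Id_s]], is positive semidefinite and its kernel is the one-dimensional span of the vector (m₁,…,m_r, n₁,…,n_s). -/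

import Mathlib

open Matrix in
theorem fromBlocks_two_neg_mulVec_inl {ι κ : Type*} [Fintype ι] [Fintype κ]
    [DecidableEq ι] [DecidableEq κ] (B : Matrix ι κ ℝ) (x : ι ⊕ κ → ℝ) (k : ι) :
    (fromBlocks (2 • (1 : Matrix ι ι ℝ)) (-B) (-Bᵀ) (2 • (1 : Matrix κ κ ℝ)) *ᵥ x) (.inl k) =
      2 * x (.inl k) - ∑ j, B k j * x (.inr j) := by
  rw [fromBlocks_mulVec, Sum.elim_inl, Pi.add_apply, smul_mulVec, one_mulVec, neg_mulVec]
  simp only [Pi.smul_apply, Pi.neg_apply, Function.comp_apply, nsmul_eq_mul, mulVec,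
    dotProduct]
  push_cast
  ring

open Matrix in
theorem fromBlocks_two_neg_mulVec_inr {ι κ : Type*} [Fintype ι] [Fintype κ]
    [DecidableEq ι] [DecidableEq κ] (B : Matrix ι κ ℝ) (x : ι ⊕ κ → ℝ) (k : κ) :
    (fromBlocks (2 • (1 : Matrix ι ι ℝ)) (-B) (-Bᵀ) (2 • (1 : Matrix κ κ ℝ)) *ᵥ x) (.inr k) =
      2 * x (.inr k) - ∑ i, B i k * x (.inl i) := by
  rw [fromBlocks_mulVec, Sum.elim_inr, Pi.add_apply, smul_mulVec, one_mulVec, neg_mulVec]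
  simp only [Pi.smul_apply, Pi.neg_apply, Function.comp_apply, nsmul_eq_mul, mulVec,
    dotProduct, transpose_apply]
  push_cast
  ring

open Matrix in
/-- The quadratic form of `[[2, -B], [-Bᵗ, 2]]` is a weighted sum of squares whenever positive
vectors `p`, `q` satisfy `B q = 2 p` and `Bᵗ p = 2 q`. -/
theorem dotProduct_fromBlocks_two_neg_mulVec {ι κ : Type*} [Fintype ι] [Fintype κ]
    [DecidableEq ι] [DecidableEq κ] (B : Matrix ι κ ℝ) (p : ι → ℝ) (q : κ → ℝ)
    (hp : ∀ i, 0 < p i) (hq : ∀ j, 0 < q j)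
    (hBq : ∀ i, ∑ j, B i j * q j = 2 * p i) (hBp : ∀ j, ∑ i, B i j * p i = 2 * q j)
    (x : ι ⊕ κ → ℝ) :
    x ⬝ᵥ (fromBlocks (2 • (1 : Matrix ι ι ℝ)) (-B) (-Bᵀ) (2 • (1 : Matrix κ κ ℝ)) *ᵥ x) =
      ∑ i, ∑ j, B i j * p i * q j * (x (.inl i) / p i - x (.inr j) / q j) ^ 2 := by
  have expand (i : ι) (j : κ) :
      B i j * p i * q j * (x (.inl i) / p i - x (.inr j) / q j) ^ 2 =
        x (.inl i) ^ 2 / p i * (B i j * q j) + x (.inr j) ^ 2 / q j * (B i j * p i)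
          - 2 * (x (.inl i) * (B i j * x (.inr j))) := by
    have := (hp i).ne'
    have := (hq j).ne'
    field_simp
    ring
  have left : ∑ i, ∑ j, x (.inl i) ^ 2 / p i * (B i j * q j) = ∑ i, 2 * x (.inl i) ^ 2 := by
    refine Finset.sum_congr rfl fun i _ => ?_
    have := (hp i).ne'
    rw [← Finset.mul_sum, hBq]
    field_simp
  have right : ∑ i, ∑ j, x (.inr j) ^ 2 / q j * (B i j * p i) = ∑ j, 2 * x (.inr j) ^ 2 := by
    rw [Finset.sum_comm]
    refine Finset.sum_congr rfl fun j _ => ?_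
    have := (hq j).ne'
    rw [← Finset.mul_sum, hBp]
    field_simp
  have cross : ∑ j, x (.inr j) * ∑ i, B i j * x (.inl i) =
      ∑ i, x (.inl i) * ∑ j, B i j * x (.inr j) := by
    simp only [Finset.mul_sum]
    rw [Finset.sum_comm]
    exact Finset.sum_congr rfl fun i _ => Finset.sum_congr rfl fun j _ => by ring
  have form : x ⬝ᵥ (fromBlocks (2 • (1 : Matrix ι ι ℝ)) (-B) (-Bᵀ) (2 • (1 : Matrix κ κ ℝ)) *ᵥ x) =
      (∑ i, (2 * x (.inl i) ^ 2 - x (.inl i) * ∑ j, B i j * x (.inr j))) +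
        ∑ j, (2 * x (.inr j) ^ 2 - x (.inr j) * ∑ i, B i j * x (.inl i)) := by
    rw [dotProduct, Fintype.sum_sum_type]
    simp only [fromBlocks_two_neg_mulVec_inl, fromBlocks_two_neg_mulVec_inr, mul_sub]
    congr 1 <;> exact Finset.sum_congr rfl fun k _ => by ring
  rw [form]
  simp only [expand, Finset.sum_sub_distrib, Finset.sum_add_distrib]
  rw [left, right, cross]
  simp only [← Finset.mul_sum]
  ring


/-- Theorem 4.1 (key step): if the multiplicity matrix `A` is indecomposable and
admits positive vectors `m`, `n` with `A n = 2m`, `Aᵗ m = 2n`, then the symmetric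
matrix `C = [[2·Id, −A], [−Aᵗ, 2·Id]]` is positive semidefinite with kernel spanned
by `(m, n)` — i.e. `C` is the Cartan matrix of an affine Dynkin diagram with
imaginary root `(m, n)`. -/
theorem stmt_19 (r s : ℕ) (hr : 1 ≤ r) (hs : 1 ≤ s)
    (A : Matrix (Fin r) (Fin s) ℕ)
    (hindec : ¬ ∃ (I : Set (Fin r)) (J : Set (Fin s)),
      (I.Nonempty ∨ J.Nonempty) ∧ (Iᶜ.Nonempty ∨ Jᶜ.Nonempty) ∧
      ∀ i j, ((i ∈ I ∧ j ∉ J) ∨ (i ∉ I ∧ j ∈ J)) → A i j = 0)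
    (m : Fin r → ℕ) (n : Fin s → ℕ) (hm : ∀ i, 0 < m i) (hn : ∀ j, 0 < n j)
    (h1 : ∀ i, ∑ j, A i j * n j = 2 * m i)
    (h2 : ∀ j, ∑ i, A i j * m i = 2 * n j)
    (C : Matrix (Fin r ⊕ Fin s) (Fin r ⊕ Fin s) ℝ)
    (hC : C = Matrix.fromBlocks
      (2 • (1 : Matrix (Fin r) (Fin r) ℝ)) (-(A.map (Nat.cast : ℕ → ℝ)))
      (-((A.map (Nat.cast : ℕ → ℝ)).transpose)) (2 • (1 : Matrix (Fin s) (Fin s) ℝ))) :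
    C.PosSemidef ∧
    LinearMap.ker C.mulVecLin
      = Submodule.span ℝ {Sum.elim (fun i => (m i : ℝ)) (fun j => (n j : ℝ))} := by
  have hp (i : Fin r) : (0 : ℝ) < m i := Nat.cast_pos.2 (hm i)
  have hq (j : Fin s) : (0 : ℝ) < n j := Nat.cast_pos.2 (hn j)
  have hBq (i : Fin r) : ∑ j, A.map (Nat.cast : ℕ → ℝ) i j * n j = 2 * m i := by
    simpa using congrArg (Nat.cast : ℕ → ℝ) (h1 i)
  have hBp (j : Fin s) : ∑ i, A.map (Nat.cast : ℕ → ℝ) i j * m i = 2 * n j := by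
    simpa using congrArg (Nat.cast : ℕ → ℝ) (h2 j)
  have form (x : Fin r ⊕ Fin s → ℝ) := dotProduct_fromBlocks_two_neg_mulVec
    (A.map (Nat.cast : ℕ → ℝ)) (fun i => (m i : ℝ)) (fun j => (n j : ℝ)) hp hq hBq hBp x
  rw [← hC] at form
  have term_nonneg (x : Fin r ⊕ Fin s → ℝ) (i : Fin r) (j : Fin s) :
      0 ≤ A.map (Nat.cast : ℕ → ℝ) i j * m i * n j *
        (x (.inl i) / m i - x (.inr j) / n j) ^ 2 := by
    rw [Matrix.map_apply]
    positivity
  refine ⟨Matrix.PosSemidef.of_dotProduct_mulVec_nonneg ?_ fun x => ?_, le_antisymm ?_ ?_⟩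
  · rw [hC, Matrix.IsHermitian, Matrix.conjTranspose_eq_transpose_of_trivial,
      Matrix.fromBlocks_transpose]
    simp
  · rw [star_trivial, form]
    exact Finset.sum_nonneg fun i _ => Finset.sum_nonneg fun j _ => term_nonneg x i j
  · intro x hx
    rw [LinearMap.mem_ker, Matrix.mulVecLin_apply] at hx
    have hzero := form x
    rw [hx, dotProduct_zero, eq_comm, Finset.sum_eq_zero_iff_of_nonneg
      fun i _ => Finset.sum_nonneg fun j _ => term_nonneg x i j] at hzero
    have ratio_eq (i : Fin r) (j : Fin s) (hA : A i j ≠ 0) :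
        x (.inl i) / m i = x (.inr j) / n j := by
      have := (Finset.sum_eq_zero_iff_of_nonneg fun j _ => term_nonneg x i j).1
        (hzero i (Finset.mem_univ i)) j (Finset.mem_univ j)
      simpa [hA, (hm i).ne', (hn j).ne', sub_eq_zero] using this
    set c := x (.inl ⟨0, hr⟩) / m ⟨0, hr⟩ with hc
    have const : ¬ ({i | x (.inl i) / m i = c}ᶜ.Nonempty ∨
        {j | x (.inr j) / n j = c}ᶜ.Nonempty) := by
      refine fun h => hindec ⟨_, _, .inl ⟨⟨0, hr⟩, hc.symm⟩, h, fun i j hij => ?_⟩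
      by_contra hA
      have := ratio_eq i j hA
      simp only [Set.mem_ofPred_eq, this] at hij
      tauto
    simp only [not_or, Set.not_nonempty_iff_eq_empty, Set.compl_empty_iff,
      Set.eq_univ_iff_forall, Set.mem_ofPred_eq] at const
    refine Submodule.mem_span_singleton.2 ⟨c, funext ?_⟩
    rintro (i | j)
    · simpa using ((div_eq_iff (hp i).ne').1 (const.1 i)).symm
    · simpa using ((div_eq_iff (hq j).ne').1 (const.2 j)).symm
  · rw [Submodule.span_singleton_le_iff_mem, LinearMap.mem_ker, Matrix.mulVecLin_apply, hC]
    funext k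
    rcases k with i | j
    · rw [fromBlocks_two_neg_mulVec_inl]
      exact sub_eq_zero.2 (hBq i).symm
    · rw [fromBlocks_two_neg_mulVec_inr]
      exact sub_eq_zero.2 (hBp j).symm
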